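/- Let k ≥ 2, let G be a k-uniform hypergraph, and consider the price competition game constructed from G with its optimal assignment x̂. For every price vector p to which x̂ is consistent, the total subsidy cost ∑_{j∈M} s_j(x̂,p) is at least τ(G), the minimum size of a node cover of G. Therefore, the minimum over all price vectors p to which x̂ is consistent of the total subsidy cost ∑_{j∈M} s_j(x̂,p) is exactly τ(G). -/

import Mathlib

open Finset

/-- A price competition game with buyer types `N` and vendors `M`
(including the special "abstain" vendor). -/
structure PCGame (N M : Type) [Fintype N] [Fintype M] where
  abstain : M
  μ : N → ℝ
  v : N → M → ℝ
  c : M → ℝ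
  μ_pos : ∀ i, 0 < μ i
  v_nonneg : ∀ i j, 0 ≤ v i j
  c_nonneg : ∀ j, 0 ≤ c j
  v_abstain : ∀ i, v i abstain = 0
  c_abstain : c abstain = 0

namespace PCGame

variable {N M : Type} [Fintype N] [Fintype M]

/-- `p` is a valid price vector: every price is at least the production cost and
the abstain vendor has price `0`. -/
def IsPrice (G : PCGame N M) (p : M → ℝ) : Prop :=
  (∀ j, G.c j ≤ p j) ∧ p G.abstain = 0

/-- `x` is a valid buyers-to-vendors assignment. -/
def IsAssignment (G : PCGame N M) (x : N → M → ℝ) : Prop :=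
  (∀ i j, 0 ≤ x i j) ∧ ∀ i, ∑ j, x i j = G.μ i

/-- `x` is consistent to `p`: positive volume goes only to utility-maximizing vendors. -/
def Consistent (G : PCGame N M) (x : N → M → ℝ) (p : M → ℝ) : Prop :=
  ∀ i j, 0 < x i j → ∀ j', G.v i j' - p j' ≤ G.v i j - p j

/-- Utility of vendor `j` under assignment `x` and prices `p`. -/
noncomputable def util (G : PCGame N M) (x : N → M → ℝ) (p : M → ℝ) (j : M) : ℝ :=
  (p j - G.c j) * ∑ i, x i j

/-- Total utility of the buyers of type `i`. -/
noncomputable def buyerUtil (G : PCGame N M) (x : N → M → ℝ) (p : M → ℝ) (i : N) : ℝ :=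
  ∑ j, x i j * (G.v i j - p j)

/-- `(x, p)` is a (pure Nash) equilibrium: `x` is consistent to `p` and no (non-abstain)
vendor can increase its utility by deviating to another price. -/
def IsEquilibrium [DecidableEq M] (G : PCGame N M) (x : N → M → ℝ) (p : M → ℝ) : Prop :=
  G.IsPrice p ∧ G.IsAssignment x ∧ G.Consistent x p ∧
    ∀ j, j ≠ G.abstain → ∀ p' : ℝ, G.c j ≤ p' →
      ∀ y, G.IsAssignment y → G.Consistent y (Function.update p j p') →
        G.util y (Function.update p j p') j ≤ G.util x p j

/-- Social welfare of assignment `x`. -/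
noncomputable def SW (G : PCGame N M) (x : N → M → ℝ) : ℝ :=
  ∑ i, ∑ j, x i j * (G.v i j - G.c j)

/-- Optimal social welfare. -/
noncomputable def SWopt (G : PCGame N M) : ℝ :=
  ∑ i, G.μ i * Finset.univ.sup' ⟨G.abstain, Finset.mem_univ _⟩ (fun j => G.v i j - G.c j)

/-- `θ_j(p)`: the supremum utility of vendor `j` over all of its price deviations
(the abstain vendor cannot deviate from price `0`). -/
noncomputable def theta [DecidableEq M] (G : PCGame N M) (p : M → ℝ) (j : M) : ℝ :=
  sSup {u : ℝ | ∃ (p' : ℝ) (y : N → M → ℝ), G.c j ≤ p' ∧ (j = G.abstain → p' = 0) ∧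
    G.IsAssignment y ∧ G.Consistent y (Function.update p j p') ∧
    u = G.util y (Function.update p j p') j}

/-- The minimum subsidy that makes vendor `j` not want to deviate from `(x, p)`. -/
noncomputable def subsidy [DecidableEq M] (G : PCGame N M) (x : N → M → ℝ) (p : M → ℝ)
    (j : M) : ℝ :=
  G.theta p j - G.util x p j

end PCGame

namespace PCGame

variable {N M : Type} [Fintype N] [Fintype M]

theorem IsAssignment.le_volume {G : PCGame N M} {x : N → M → ℝ} (hx : G.IsAssignment x)
    (i : N) (j : M) : x i j ≤ G.μ i :=
  hx.2 i ▸ Finset.single_le_sum (fun j' _ => hx.1 i j') (Finset.mem_univ j)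

variable [DecidableEq M]

/-- Whatever the prices, buyers in `S` for whom `j` is optimal can all be served by `j`. -/
theorem exists_consistent_of_optimal (G : PCGame N M) (q : M → ℝ) (j : M) (S : Finset N)
    (hS : ∀ i ∈ S, ∀ j', G.v i j' - q j' ≤ G.v i j - q j) :
    ∃ y, G.IsAssignment y ∧ G.Consistent y q ∧ ∀ i ∈ S, y i j = G.μ i := by
  have hopt : ∀ i, ∃ m, (∀ j', G.v i j' - q j' ≤ G.v i m - q m) ∧ (i ∈ S → m = j) := by
    intro i
    by_cases hi : i ∈ S
    · exact ⟨j, hS i hi, fun _ => rfl⟩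
    · obtain ⟨m, -, hm⟩ := Finset.exists_max_image Finset.univ (fun m => G.v i m - q m)
        ⟨G.abstain, Finset.mem_univ _⟩
      exact ⟨m, fun j' => hm j' (Finset.mem_univ _), fun h => absurd h hi⟩
  choose f hf hfS using hopt
  refine ⟨fun i m => if m = f i then G.μ i else 0, ⟨fun i m => ?_, fun i => by simp⟩,
    fun i m hm => ?_, fun i hi => by simp [hfS i hi]⟩
  · dsimp only
    split_ifs
    exacts [(G.μ_pos i).le, le_rfl]
  · by_cases h : m = f i
    · exact h ▸ hf i
    · simp [h] at hm

theorem bddAbove_deviations (G : PCGame N M) {p : M → ℝ} (hp : p G.abstain = 0) {j : M}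
    (hj : j ≠ G.abstain) :
    BddAbove {u : ℝ | ∃ (p' : ℝ) (y : N → M → ℝ), G.c j ≤ p' ∧ (j = G.abstain → p' = 0) ∧
      G.IsAssignment y ∧ G.Consistent y (Function.update p j p') ∧
      u = G.util y (Function.update p j p') j} := by
  refine ⟨∑ i, G.v i j * G.μ i, ?_⟩
  rintro u ⟨p', y, -, -, hy, hcons, rfl⟩
  rw [util, Function.update_self, Finset.mul_sum]
  refine Finset.sum_le_sum fun i _ => ?_
  have hv := G.v_nonneg i j
  have hc := G.c_nonneg j
  rcases (hy.1 i j).eq_or_lt with h0 | h0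
  · rw [← h0, mul_zero]
    exact mul_nonneg hv (G.μ_pos i).le
  · have h := hcons i j h0 G.abstain
    rw [Function.update_self, Function.update_of_ne hj.symm, G.v_abstain, hp] at h
    calc (p' - G.c j) * y i j ≤ G.v i j * y i j :=
          mul_le_mul_of_nonneg_right (by linarith) h0.le
      _ ≤ G.v i j * G.μ i := mul_le_mul_of_nonneg_left (hy.le_volume i j) hv

/-- Lower bound on `θ_j` from a deviation to `p'` that wins the buyer types in `S`. -/
theorem le_theta (G : PCGame N M) {p : M → ℝ} (hp : p G.abstain = 0) {j : M}
    (hj : j ≠ G.abstain) {p' : ℝ} (hp' : G.c j ≤ p') (S : Finset N)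
    (hS : ∀ i ∈ S, ∀ j', j' ≠ j → G.v i j' - p j' ≤ G.v i j - p') :
    (p' - G.c j) * ∑ i ∈ S, G.μ i ≤ G.theta p j := by
  obtain ⟨y, hy, hcons, hyS⟩ :=
    G.exists_consistent_of_optimal (Function.update p j p') j S (by
      intro i hi j'
      by_cases h : j' = j
      · rw [h]
      · rw [Function.update_self, Function.update_of_ne h]
        exact hS i hi j' h)
  refine le_trans ?_ (le_csSup (G.bddAbove_deviations hp hj)
    ⟨p', y, hp', fun h => absurd h hj, hy, hcons, rfl⟩)
  rw [util, Function.update_self, ← Finset.sum_congr rfl hyS]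
  exact mul_le_mul_of_nonneg_left
    (Finset.sum_le_sum_of_subset_of_nonneg (Finset.subset_univ S) fun i _ _ => hy.1 i j)
    (sub_nonneg.2 hp')

/-- Upper bound on `θ_j`: at every price `p'` above cost, only buyer types in some set `S` of
suitably small volume do not strictly prefer another vendor. -/
theorem theta_le (G : PCGame N M) {p : M → ℝ} {j : M} {B : ℝ} (hB : 0 ≤ B)
    (h : ∀ p', G.c j < p' → ∃ S : Finset N,
      (∀ i, i ∉ S → ∃ j', j' ≠ j ∧ G.v i j - p' < G.v i j' - p j') ∧
      (p' - G.c j) * ∑ i ∈ S, G.μ i ≤ B) :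
    G.theta p j ≤ B := by
  refine Real.sSup_le ?_ hB
  rintro u ⟨p', y, hp', -, hy, hcons, rfl⟩
  rw [util, Function.update_self]
  rcases hp'.eq_or_lt with h0 | h0
  · rwa [h0, sub_self, zero_mul]
  obtain ⟨S, hS, hSB⟩ := h p' h0
  refine le_trans (mul_le_mul_of_nonneg_left ?_ (sub_nonneg.2 hp')) hSB
  have hout : ∀ i, i ∉ S → y i j = 0 := by
    intro i hi
    by_contra hne
    obtain ⟨j', hj', hlt⟩ := hS i hi
    have := hcons i j ((hy.1 i j).lt_of_ne' hne) j'
    rw [Function.update_self, Function.update_of_ne hj'] at this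
    linarith
  rw [← Finset.sum_subset (Finset.subset_univ S) fun i _ hi => hout i hi]
  exact Finset.sum_le_sum fun i _ => hy.le_volume i j

theorem theta_abstain (G : PCGame N M) (p : M → ℝ) : G.theta p G.abstain ≤ 0 := by
  refine Real.sSup_le ?_ le_rfl
  rintro u ⟨p', y, -, hp', -, -, rfl⟩
  rw [util, Function.update_self, hp' rfl, G.c_abstain]
  simp

theorem theta_abstain_nonneg (G : PCGame N M) (p : M → ℝ) : 0 ≤ G.theta p G.abstain := by
  refine Real.sSup_nonneg ?_
  rintro u ⟨p', y, -, hp', -, -, rfl⟩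
  rw [util, Function.update_self, hp' rfl, G.c_abstain]
  simp

theorem subsidy_abstain (G : PCGame N M) (x : N → M → ℝ) {p : M → ℝ} (hp : p G.abstain = 0) :
    G.subsidy x p G.abstain = 0 := by
  rw [subsidy, le_antisymm (G.theta_abstain p) (G.theta_abstain_nonneg p), util, hp, G.c_abstain]
  simp

end PCGame

/-- If every edge `s` is heavy (`k ≤ b s`), or meets a heavy edge, or has a node `j` with
`1 ≤ a j + b s`, then some node cover has size at most the total weight. -/
theorem exists_cover_card_le {V ι : Type} [Fintype V] [DecidableEq V] [Fintype ι] {k : ℕ}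
    (hk : 0 < k) (edge : ι → Finset V) (hedge : ∀ s, (edge s).card = k) (a : V → ℝ) (b : ι → ℝ)
    (ha : ∀ j, 0 ≤ a j) (hb : ∀ s, 0 ≤ b s)
    (h : ∀ s, (∀ j ∈ edge s, ∀ t, j ∈ edge t → b t < k) → ∃ j ∈ edge s, 1 ≤ a j + b s) :
    ∃ C : Finset V, (∀ s, ∃ j ∈ C, j ∈ edge s) ∧ (C.card : ℝ) ≤ ∑ j, a j + ∑ s, b s := by
  classical
  have hne : ∀ s, (edge s).Nonempty := fun s => Finset.card_pos.1 (hedge s ▸ hk)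
  let H : Finset ι := {s | (k : ℝ) ≤ b s}
  let L : Finset ι := {s | ∀ j ∈ edge s, ∀ t, j ∈ edge t → b t < k}
  have hex : ∀ s ∈ L, ∃ j ∈ edge s, 1 ≤ a j + b s := fun s hs =>
    h s (Finset.mem_filter.1 hs).2
  rcases isEmpty_or_nonempty V with hV | hV
  · refine ⟨∅, fun s => (hV.false (hne s).choose).elim, ?_⟩
    simpa using Finset.sum_nonneg fun s _ => hb s
  choose! f hf using hex
  have hHcard : ((H.biUnion edge).card : ℝ) ≤ ∑ s ∈ H, b s := by
    calc ((H.biUnion edge).card : ℝ) ≤ ((∑ s ∈ H, (edge s).card : ℕ) : ℝ) := by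
          exact_mod_cast Finset.card_biUnion_le
      _ = ∑ s ∈ H, (k : ℝ) := by push_cast [hedge]; rfl
      _ ≤ ∑ s ∈ H, b s := Finset.sum_le_sum fun s hs => (Finset.mem_filter.1 hs).2
  have hLcard : ((L.image f).card : ℝ) ≤ ∑ j, a j + ∑ s ∈ L, b s := by
    calc ((L.image f).card : ℝ) = ∑ j ∈ L.image f, (1 : ℝ) := by simp
      _ ≤ ∑ j ∈ L.image f, (a j + ∑ s ∈ L with f s = j, b s) := by
          refine Finset.sum_le_sum fun j hj => ?_
          obtain ⟨s, hs, rfl⟩ := Finset.mem_image.1 hj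
          refine (hf s hs).2.trans (add_le_add le_rfl ?_)
          exact Finset.single_le_sum (f := b) (fun t _ => hb t)
            (Finset.mem_filter.2 ⟨hs, rfl⟩)
      _ = ∑ j ∈ L.image f, a j + ∑ s ∈ L, b s := by
          rw [Finset.sum_add_distrib, Finset.sum_fiberwise_of_maps_to
            fun s hs => Finset.mem_image_of_mem f hs]
      _ ≤ _ := add_le_add (Finset.sum_le_sum_of_subset_of_nonneg (Finset.subset_univ _)
          fun j _ _ => ha j) le_rfl
  have hdisj : Disjoint H L := by
    rw [Finset.disjoint_left]
    intro s hsH hsL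
    obtain ⟨j, hj⟩ := hne s
    exact ((Finset.mem_filter.1 hsL).2 j hj s hj).not_ge (Finset.mem_filter.1 hsH).2
  have hsum : ∑ s ∈ H, b s + ∑ s ∈ L, b s ≤ ∑ s, b s := by
    rw [← Finset.sum_union hdisj]
    exact Finset.sum_le_sum_of_subset_of_nonneg (Finset.subset_univ _) fun s _ _ => hb s
  have hunion : ((H.biUnion edge ∪ L.image f).card : ℝ) ≤
      (H.biUnion edge).card + (L.image f).card := by
    exact_mod_cast Finset.card_union_le _ _
  refine ⟨H.biUnion edge ∪ L.image f, fun s => ?_, by linarith⟩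
  by_cases hs : s ∈ L
  · exact ⟨f s, Finset.mem_union_right _ (Finset.mem_image_of_mem f hs), (hf s hs).1⟩
  · obtain ⟨j, hj, t, hjt, ht⟩ : ∃ j ∈ edge s, ∃ t, j ∈ edge t ∧ (k : ℝ) ≤ b t := by
      by_contra! hcon
      exact hs (Finset.mem_filter.2 ⟨Finset.mem_univ s, hcon⟩)
    exact ⟨j, Finset.mem_union_left _ (Finset.mem_biUnion.2
      ⟨t, Finset.mem_filter.2 ⟨Finset.mem_univ t, ht⟩, hjt⟩), hj⟩

/-- `G` is the price competition game constructed from the `k`-uniform hypergraph `E`. -/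
structure IsNodeCoverGame {V : Type} [Fintype V] [DecidableEq V] (k : ℕ)
    (E : Finset (Finset V)) (G : PCGame (↥E ⊕ V ⊕ V) (Option (↥E ⊕ V ⊕ V))) : Prop where
  abstain : G.abstain = none
  volume_edge : ∀ e : ↥E, G.μ (Sum.inl e) = 1
  volume_node : ∀ j : V, G.μ (Sum.inr (Sum.inl j)) = 1
  volume_aux : ∀ j : V, G.μ (Sum.inr (Sum.inr j)) = 1 / ((k : ℝ) + 2)
  cost : ∀ m, G.c m = 0
  edge_edge : ∀ e e' : ↥E, G.v (Sum.inl e) (some (Sum.inl e')) =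
    if e = e' then ((k : ℝ) + 1) ^ 2 else 0
  edge_node : ∀ (e : ↥E) (j : V), G.v (Sum.inl e) (some (Sum.inr (Sum.inl j))) = 0
  edge_aux : ∀ (e : ↥E) (j : V), G.v (Sum.inl e) (some (Sum.inr (Sum.inr j))) = 0
  node_edge : ∀ (j : V) (e : ↥E), G.v (Sum.inr (Sum.inl j)) (some (Sum.inl e)) =
    if j ∈ e.1 then (k : ℝ) + 2 else 0
  node_node : ∀ j j' : V, G.v (Sum.inr (Sum.inl j)) (some (Sum.inr (Sum.inl j'))) =
    if j = j' then (k : ℝ) + 3 else 0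
  node_aux : ∀ j j' : V, G.v (Sum.inr (Sum.inl j)) (some (Sum.inr (Sum.inr j'))) = 0
  aux_edge : ∀ (j : V) (e : ↥E), G.v (Sum.inr (Sum.inr j)) (some (Sum.inl e)) = 0
  aux_node : ∀ j j' : V, G.v (Sum.inr (Sum.inr j)) (some (Sum.inr (Sum.inl j'))) =
    if j = j' then (k : ℝ) + 2 else 0
  aux_aux : ∀ j j' : V, G.v (Sum.inr (Sum.inr j)) (some (Sum.inr (Sum.inr j'))) =
    if j = j' then (k : ℝ) + 3 else 0

namespace IsNodeCoverGame

variable {V : Type} [Fintype V] [DecidableEq V] {k : ℕ} {E : Finset (Finset V)}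
  {G : PCGame (↥E ⊕ V ⊕ V) (Option (↥E ⊕ V ⊕ V))}
  {x : (↥E ⊕ V ⊕ V) → Option (↥E ⊕ V ⊕ V) → ℝ} {p : Option (↥E ⊕ V ⊕ V) → ℝ}

theorem valuation_none (h : IsNodeCoverGame k E G) (i : ↥E ⊕ V ⊕ V) : G.v i none = 0 :=
  h.abstain ▸ G.v_abstain i

theorem some_ne_abstain (h : IsNodeCoverGame k E G) (i : ↥E ⊕ V ⊕ V) : some i ≠ G.abstain := by
  simp [h.abstain]

/-- The buyers sought by edge vendor `e`: its own buyer and the node buyers in `T`. -/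
theorem sum_volume_edge_nodes (h : IsNodeCoverGame k E G) (e : ↥E) (T : Finset V) :
    ∑ i ∈ insert (Sum.inl e) (T.image fun j => Sum.inr (Sum.inl j)), G.μ i = 1 + T.card := by
  rw [Finset.sum_insert (by simp), Finset.sum_image (by simp), h.volume_edge]
  simp [h.volume_node]

theorem subsidy_some (h : IsNodeCoverGame k E G)
    (hx : ∀ i m, x i m = if m = some i then G.μ i else 0) (i : ↥E ⊕ V ⊕ V) :
    G.subsidy x p (some i) = G.theta p (some i) - p (some i) * G.μ i := by
  simp [PCGame.subsidy, PCGame.util, hx, h.cost]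

theorem sum_subsidy (h : IsNodeCoverGame k E G) (hp : G.IsPrice p) :
    ∑ m, G.subsidy x p m = ∑ e : ↥E, G.subsidy x p (some (Sum.inl e)) +
      (∑ j : V, G.subsidy x p (some (Sum.inr (Sum.inl j))) +
        ∑ j : V, G.subsidy x p (some (Sum.inr (Sum.inr j)))) := by
  rw [Fintype.sum_option, ← h.abstain, G.subsidy_abstain x hp.2, zero_add, Fintype.sum_sum_type,
    Fintype.sum_sum_type]

/-- Any price vector supporting the optimal assignment has total subsidy at least the size of
some node cover. -/
theorem exists_cover_le_sum_subsidy (h : IsNodeCoverGame k E G) (hk : 2 ≤ k)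
    (hE : ∀ S ∈ E, S.card = k) (hx : ∀ i m, x i m = if m = some i then G.μ i else 0)
    (hp : G.IsPrice p) (hcons : G.Consistent x p) :
    ∃ C : Finset V, (∀ S ∈ E, ∃ j ∈ C, j ∈ S) ∧ (C.card : ℝ) ≤ ∑ m, G.subsidy x p m := by
  have hk' : (2 : ℝ) ≤ k := by exact_mod_cast hk
  have hopt : ∀ i m, G.v i m - p m ≤ G.v i (some i) - p (some i) := fun i =>
    hcons i (some i) (by simpa [hx] using G.μ_pos i)
  have hpos : ∀ m, 0 ≤ p m := fun m => h.cost m ▸ hp.1 m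
  have hnone : p none = 0 := h.abstain ▸ hp.2
  have htheta : ∀ i p', 0 ≤ p' → ∀ S : Finset (↥E ⊕ V ⊕ V),
      (∀ i' ∈ S, ∀ m, m ≠ some i → G.v i' m - p m ≤ G.v i' (some i) - p') →
      p' * ∑ i' ∈ S, G.μ i' ≤ G.theta p (some i) := by
    intro i p' hp' S hS
    simpa [h.cost] using
      G.le_theta hp.2 (h.some_ne_abstain i) ((h.cost _).le.trans hp') S hS
  have hnonneg : ∀ i, 0 ≤ G.subsidy x p (some i) := by
    intro i
    rw [h.subsidy_some hx, sub_nonneg]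
    simpa using htheta i (p (some i)) (hpos _) {i} (by
      intro i' hi' m _
      rw [Finset.mem_singleton.1 hi']
      exact hopt i m)
  have hedge_le : ∀ e : ↥E, p (some (Sum.inl e)) ≤ ((k : ℝ) + 1) ^ 2 := by
    intro e
    simpa [h.valuation_none, hnone, h.edge_edge] using hopt (Sum.inl e) none
  have hnode_le : ∀ j : V, p (some (Sum.inr (Sum.inl j))) ≤ (k : ℝ) + 3 := by
    intro j
    simpa [h.valuation_none, hnone, h.node_node] using hopt (Sum.inr (Sum.inl j)) none
  have hedge : ∀ e : ↥E, ((k : ℝ) + 1) ^ 2 - p (some (Sum.inl e)) ≤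
      G.subsidy x p (some (Sum.inl e)) := by
    intro e
    rw [h.subsidy_some hx, h.volume_edge, mul_one, sub_le_sub_iff_right]
    have := htheta (Sum.inl e) (((k : ℝ) + 1) ^ 2) (by positivity) {Sum.inl e} (by
      simp only [Finset.mem_singleton, forall_eq]
      intro m hm
      rcases m with _ | e' | j | j
      · simp [h.valuation_none, hnone, h.edge_edge]
      · have hne : e ≠ e' := fun h' => hm (h' ▸ rfl)
        simpa [h.edge_edge, hne] using hpos _
      · simpa [h.edge_edge, h.edge_node] using hpos _
      · simpa [h.edge_edge, h.edge_aux] using hpos _)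
    simpa [h.volume_edge] using this
  have hnode : ∀ j : V, (∀ e : ↥E, j ∈ e.1 → G.subsidy x p (some (Sum.inl e)) < k) →
      (k : ℝ) + 3 - p (some (Sum.inr (Sum.inl j))) ≤
        G.subsidy x p (some (Sum.inr (Sum.inl j))) := by
    intro j hj
    rw [h.subsidy_some hx, h.volume_node, mul_one, sub_le_sub_iff_right]
    have := htheta (Sum.inr (Sum.inl j)) ((k : ℝ) + 3) (by positivity) {Sum.inr (Sum.inl j)} (by
      simp only [Finset.mem_singleton, forall_eq]
      intro m hm
      rcases m with _ | e | j' | j'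
      · simp [h.valuation_none, hnone, h.node_node]
      · have := hpos (some (Sum.inl e))
        by_cases hje : j ∈ e.1
        · have h1 := hj e hje
          have h2 := hedge e
          simp only [h.node_edge, h.node_node, hje, if_true]
          nlinarith
        · simpa [h.node_node, h.node_edge, hje] using this
      · have hne : j ≠ j' := fun h' => hm (h' ▸ rfl)
        simpa [h.node_node, hne] using hpos _
      · simpa [h.node_node, h.node_aux] using hpos _)
    simpa [h.volume_node] using this
  obtain ⟨C, hC, hcard⟩ := exists_cover_card_le (by lia) (fun e : ↥E => e.1)
    (fun e => hE e.1 e.2) (fun j => G.subsidy x p (some (Sum.inr (Sum.inl j))))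
    (fun e => G.subsidy x p (some (Sum.inl e))) (fun _ => hnonneg _) (fun _ => hnonneg _) (by
      intro e hlight
      by_contra! hcon
      obtain ⟨j, hj, hmin⟩ := Finset.exists_min_image e.1
        (fun j => p (some (Sum.inr (Sum.inl j))))
        (Finset.card_pos.1 (by rw [hE e.1 e.2]; lia))
      have hs := hnonneg (Sum.inl e)
      have hj1 := hcon j hj
      have hj2 := hnode j (hlight j hj)
      have hj3 := hnode_le j
      have hdev := htheta (Sum.inl e) (p (some (Sum.inr (Sum.inl j))) - 1) (by linarith)
        (insert (Sum.inl e) (e.1.image fun j => Sum.inr (Sum.inl j))) (by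
          intro i hi m hm
          rw [Finset.mem_insert, Finset.mem_image] at hi
          rcases hi with rfl | ⟨l, hl, rfl⟩
          · have : p (some (Sum.inr (Sum.inl j))) - 1 ≤ ((k : ℝ) + 1) ^ 2 := by nlinarith
            rcases m with _ | e' | j' | j'
            · simp only [h.valuation_none, hnone, h.edge_edge, if_true]
              linarith
            · have hne : e ≠ e' := fun h' => hm (h' ▸ rfl)
              simp only [h.edge_edge, hne, if_true, if_false]
              linarith [hpos (some (Sum.inl e'))]
            · simp only [h.edge_edge, h.edge_node, if_true]
              linarith [hpos (some (Sum.inr (Sum.inl j')))]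
            · simp only [h.edge_edge, h.edge_aux, if_true]
              linarith [hpos (some (Sum.inr (Sum.inr j')))]
          · have h1 := hopt (Sum.inr (Sum.inl l)) m
            have h2 := hmin l hl
            rw [h.node_node, if_pos rfl] at h1
            rw [h.node_edge, if_pos hl]
            linarith)
      rw [h.sum_volume_edge_nodes, hE e.1 e.2] at hdev
      have hsub := h.subsidy_some (p := p) hx (Sum.inl e)
      rw [h.volume_edge, mul_one] at hsub
      have hle := hedge_le e
      nlinarith)
  refine ⟨C, fun S hS => hC ⟨S, hS⟩, hcard.trans ?_⟩
  rw [h.sum_subsidy hp]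
  have := Finset.sum_nonneg fun (j : V) (_ : j ∈ Finset.univ) => hnonneg (Sum.inr (Sum.inr j))
  linarith

/-- Prices supporting the optimal assignment whose total subsidy is at most the size of the
node cover `C`: nodes in `C` are discounted by one. -/
theorem exists_price_sum_subsidy_le (h : IsNodeCoverGame k E G) (hk : 2 ≤ k)
    (hE : ∀ S ∈ E, S.card = k) (hx : ∀ i m, x i m = if m = some i then G.μ i else 0)
    (C : Finset V) (hC : ∀ S ∈ E, ∃ j ∈ C, j ∈ S) :
    ∃ p, G.IsPrice p ∧ G.Consistent x p ∧ ∑ m, G.subsidy x p m ≤ C.card := by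
  have hk' : (2 : ℝ) ≤ k := by exact_mod_cast hk
  let p : Option (↥E ⊕ V ⊕ V) → ℝ
    | none => 0
    | some (Sum.inl _) => ((k : ℝ) + 1) ^ 2
    | some (Sum.inr (Sum.inl j)) => if j ∈ C then (k : ℝ) + 2 else (k : ℝ) + 3
    | some (Sum.inr (Sum.inr _)) => (k : ℝ) + 3
  have hnone : p none = 0 := rfl
  have hpe : ∀ e, p (some (Sum.inl e)) = ((k : ℝ) + 1) ^ 2 := fun _ => rfl
  have hpn : ∀ j, p (some (Sum.inr (Sum.inl j))) = if j ∈ C then (k : ℝ) + 2 else (k : ℝ) + 3 :=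
    fun _ => rfl
  have hpa : ∀ j, p (some (Sum.inr (Sum.inr j))) = (k : ℝ) + 3 := fun _ => rfl
  have hpos : ∀ m, 0 ≤ p m := by
    rintro (_ | e | j | j)
    · exact le_rfl
    · rw [hpe e]; positivity
    · rw [hpn j]; split_ifs <;> positivity
    · rw [hpa j]; positivity
  have hprice : G.IsPrice p := ⟨fun m => (h.cost m).symm ▸ hpos m, h.abstain.symm ▸ hnone⟩
  have htheta : ∀ i B, 0 ≤ B → (∀ p', 0 < p' → ∃ S : Finset (↥E ⊕ V ⊕ V),
      (∀ i', i' ∉ S → ∃ m, m ≠ some i ∧ G.v i' (some i) - p' < G.v i' m - p m) ∧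
      p' * ∑ i' ∈ S, G.μ i' ≤ B) → G.theta p (some i) ≤ B := by
    intro i B hB hS
    exact G.theta_le hB (by simpa only [h.cost, sub_zero] using hS)
  have houtside : ∀ i i' p', G.v i' (some i) < p' →
      ∃ m, m ≠ some i ∧ G.v i' (some i) - p' < G.v i' m - p m := fun i i' p' hlt =>
    ⟨none, by simp, by rw [h.valuation_none, hnone]; linarith⟩
  have hedge : ∀ e : ↥E, G.subsidy x p (some (Sum.inl e)) ≤ 0 := by
    intro e
    rw [h.subsidy_some hx, hpe e, h.volume_edge, mul_one, sub_nonpos]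
    refine htheta _ _ (by positivity) fun p' hp' => ?_
    by_cases hown : ((k : ℝ) + 1) ^ 2 < p'
    · refine ⟨∅, fun i' _ => houtside _ _ _ ?_, by simpa using by positivity⟩
      rcases i' with e' | j | j
      · rw [h.edge_edge]; split_ifs <;> linarith
      · rw [h.node_edge]; split_ifs <;> nlinarith
      · rwa [h.aux_edge]
    push Not at hown
    obtain ⟨T, hT, hTB⟩ : ∃ T : Finset V, (∀ j ∈ e.1, j ∉ T → (k : ℝ) + 2 < p' ∨
        j ∈ C ∧ (k : ℝ) + 1 < p') ∧ p' * (1 + T.card) ≤ ((k : ℝ) + 1) ^ 2 := by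
      by_cases h1 : p' ≤ (k : ℝ) + 1
      · refine ⟨e.1, fun j hj hj' => absurd hj hj', ?_⟩
        rw [hE e.1 e.2]
        nlinarith
      push Not at h1
      by_cases h2 : p' ≤ (k : ℝ) + 2
      · obtain ⟨c, hcC, hce⟩ := hC e.1 e.2
        refine ⟨e.1.erase c, fun j hj hj' => Or.inr ⟨?_, h1⟩, ?_⟩
        · obtain rfl : j = c := by simpa [hj] using hj'
          exact hcC
        · have := Finset.card_erase_add_one hce
          rw [hE e.1 e.2] at this
          have : ((e.1.erase c).card : ℝ) + 1 = k := by exact_mod_cast this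
          nlinarith
      · exact ⟨∅, fun j _ _ => Or.inl (not_le.1 h2), by simpa using hown⟩
    refine ⟨insert (Sum.inl e) (T.image fun j => Sum.inr (Sum.inl j)), fun i' hi' => ?_, by
      rwa [h.sum_volume_edge_nodes]⟩
    rcases i' with e' | j | j
    · have hne : e' ≠ e := by rintro rfl; simp at hi'
      exact houtside _ _ _ (by simpa [h.edge_edge, hne] using hp')
    · have hjT : j ∉ T := by simpa using hi'
      by_cases hje : j ∈ e.1
      · rcases hT j hje hjT with hlt | ⟨hjC, hlt⟩
        · exact houtside _ _ _ (by simpa [h.node_edge, hje] using hlt)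
        · refine ⟨some (Sum.inr (Sum.inl j)), by simp, ?_⟩
          rw [h.node_edge, h.node_node, hpn j, if_pos hje, if_pos rfl, if_pos hjC]
          linarith
      · exact houtside _ _ _ (by simpa [h.node_edge, hje] using hp')
    · exact houtside _ _ _ (by rwa [h.aux_edge])
  have hnode : ∀ j : V, G.subsidy x p (some (Sum.inr (Sum.inl j))) ≤
      if j ∈ C then 1 else 0 := by
    intro j
    have hle : G.theta p (some (Sum.inr (Sum.inl j))) ≤ (k : ℝ) + 3 := by
      refine htheta _ _ (by positivity) fun p' hp' => ?_
      have hother : ∀ i', i' ≠ Sum.inr (Sum.inl j) → i' ≠ Sum.inr (Sum.inr j) →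
          G.v i' (some (Sum.inr (Sum.inl j))) < p' := by
        rintro (e | j' | j') h1 h2
        · rwa [h.edge_node]
        · rwa [h.node_node, if_neg (by rintro rfl; exact h1 rfl)]
        · rwa [h.aux_node, if_neg (by rintro rfl; exact h2 rfl)]
      by_cases h2 : p' ≤ (k : ℝ) + 2
      · refine ⟨{Sum.inr (Sum.inl j), Sum.inr (Sum.inr j)}, fun i' hi' => ?_, ?_⟩
        · simp only [Finset.mem_insert, Finset.mem_singleton, not_or] at hi'
          exact houtside _ _ _ (hother i' hi'.1 hi'.2)
        · rw [Finset.sum_pair (by simp), h.volume_node, h.volume_aux]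
          calc p' * (1 + 1 / ((k : ℝ) + 2)) ≤ ((k : ℝ) + 2) * (1 + 1 / ((k : ℝ) + 2)) :=
                mul_le_mul_of_nonneg_right h2 (by positivity)
            _ = (k : ℝ) + 3 := by field_simp; ring
      push Not at h2
      have haux : ∀ i', i' ≠ Sum.inr (Sum.inl j) →
          G.v i' (some (Sum.inr (Sum.inl j))) < p' := by
        intro i' hi'
        by_cases hi'' : i' = Sum.inr (Sum.inr j)
        · rwa [hi'', h.aux_node, if_pos rfl]
        · exact hother i' hi' hi''
      by_cases h3 : p' ≤ (k : ℝ) + 3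
      · exact ⟨{Sum.inr (Sum.inl j)},
          fun i' hi' => houtside _ _ _ (haux i' (by simpa using hi')),
          by simpa [h.volume_node] using h3⟩
      · refine ⟨∅, fun i' _ => houtside _ _ _ ?_, by simpa using by positivity⟩
        by_cases hi' : i' = Sum.inr (Sum.inl j)
        · rw [hi', h.node_node, if_pos rfl]
          exact not_le.1 h3
        · exact haux i' hi'
    rw [h.subsidy_some hx, hpn j, h.volume_node]
    split_ifs <;> linarith
  have haux : ∀ j : V, G.subsidy x p (some (Sum.inr (Sum.inr j))) ≤ 0 := by
    intro j
    rw [h.subsidy_some hx, hpa j, h.volume_aux, sub_nonpos]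
    refine htheta _ _ (by positivity) fun p' hp' => ?_
    have hother : ∀ i', i' ≠ Sum.inr (Sum.inr j) →
        G.v i' (some (Sum.inr (Sum.inr j))) < p' := by
      rintro (e | j' | j') h1
      · rwa [h.edge_aux]
      · rwa [h.node_aux]
      · rwa [h.aux_aux, if_neg (by rintro rfl; exact h1 rfl)]
    by_cases h3 : p' ≤ (k : ℝ) + 3
    · refine ⟨{Sum.inr (Sum.inr j)},
        fun i' hi' => houtside _ _ _ (hother i' (by simpa using hi')), ?_⟩
      rw [Finset.sum_singleton, h.volume_aux]
      exact mul_le_mul_of_nonneg_right h3 (by positivity)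
    · refine ⟨∅, fun i' _ => houtside _ _ _ ?_, by simpa using by positivity⟩
      by_cases hi' : i' = Sum.inr (Sum.inr j)
      · rw [hi', h.aux_aux, if_pos rfl]
        exact not_le.1 h3
      · exact hother i' hi'
  refine ⟨p, hprice, ?_, ?_⟩
  · intro i m hm m'
    have hmi : m = some i := by
      by_contra hne
      simp [hx, hne] at hm
    subst hmi
    have hm' := hpos m'
    rcases i with e | j | j
    · rcases m' with _ | e' | j' | j'
      · simp [h.valuation_none, hnone, h.edge_edge, hpe]
      · simp only [h.edge_edge, hpe, if_true]
        split_ifs <;> nlinarith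
      · simp only [h.edge_edge, h.edge_node, hpe, if_true]
        linarith
      · simp only [h.edge_edge, h.edge_aux, hpe, if_true]
        linarith
    · have hown : 0 ≤ (k : ℝ) + 3 - p (some (Sum.inr (Sum.inl j))) := by
        rw [hpn j]
        split_ifs <;> linarith
      rw [h.node_node, if_pos rfl]
      rcases m' with _ | e' | j' | j'
      · simpa [h.valuation_none, hnone] using hown
      · rw [h.node_edge, hpe e']
        split_ifs <;> nlinarith
      · by_cases hj : j = j'
        · simp [hj, h.node_node]
        · rw [h.node_node, if_neg hj]
          linarith
      · rw [h.node_aux]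
        linarith
    · rw [h.aux_aux, if_pos rfl, hpa j, sub_self]
      rcases m' with _ | e' | j' | j'
      · simp [h.valuation_none, hnone]
      · rw [h.aux_edge]
        linarith
      · rw [h.aux_node, hpn j']
        split_ifs <;> linarith
      · rw [h.aux_aux, hpa j']
        split_ifs <;> linarith
  · rw [h.sum_subsidy hprice]
    have h1 := Finset.sum_nonpos fun (e : ↥E) (_ : e ∈ Finset.univ) => hedge e
    have h2 := Finset.sum_nonpos fun (j : V) (_ : j ∈ Finset.univ) => haux j
    have h3 := Finset.sum_le_sum fun (j : V) (_ : j ∈ Finset.univ) => hnode j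
    rw [Finset.sum_boole, Finset.filter_univ_mem] at h3
    linarith

end IsNodeCoverGame

/-- in the node-cover game, every price vector to which the optimal
assignment is consistent has total subsidy cost at least `τ(G)`, the minimum node
cover size; hence the minimum total subsidy cost is exactly `τ(G)`.
(Same encoding of buyers and vendors as in Statement 15.) -/
theorem stmt16 {V : Type} [Fintype V] [DecidableEq V] (k : ℕ) (hk : 2 ≤ k)
    (E : Finset (Finset V)) (hE : ∀ S ∈ E, S.card = k)
    (G : PCGame (↥E ⊕ V ⊕ V) (Option (↥E ⊕ V ⊕ V)))
    (hab : G.abstain = none)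
    (hμe : ∀ e : ↥E, G.μ (Sum.inl e) = 1)
    (hμj : ∀ j : V, G.μ (Sum.inr (Sum.inl j)) = 1)
    (hμs : ∀ j : V, G.μ (Sum.inr (Sum.inr j)) = 1 / ((k : ℝ) + 2))
    (hcost : ∀ m, G.c m = 0)
    (hve : ∀ e e' : ↥E, G.v (Sum.inl e) (some (Sum.inl e')) =
      if e = e' then ((k : ℝ) + 1) ^ 2 else 0)
    (hven : ∀ (e : ↥E) (j : V), G.v (Sum.inl e) (some (Sum.inr (Sum.inl j))) = 0)
    (hvea : ∀ (e : ↥E) (j : V), G.v (Sum.inl e) (some (Sum.inr (Sum.inr j))) = 0)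
    (hvje : ∀ (j : V) (e : ↥E), G.v (Sum.inr (Sum.inl j)) (some (Sum.inl e)) =
      if j ∈ e.1 then (k : ℝ) + 2 else 0)
    (hvjn : ∀ j j' : V, G.v (Sum.inr (Sum.inl j)) (some (Sum.inr (Sum.inl j'))) =
      if j = j' then (k : ℝ) + 3 else 0)
    (hvja : ∀ j j' : V, G.v (Sum.inr (Sum.inl j)) (some (Sum.inr (Sum.inr j'))) = 0)
    (hvse : ∀ (j : V) (e : ↥E), G.v (Sum.inr (Sum.inr j)) (some (Sum.inl e)) = 0)
    (hvsn : ∀ j j' : V, G.v (Sum.inr (Sum.inr j)) (some (Sum.inr (Sum.inl j'))) =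
      if j = j' then (k : ℝ) + 2 else 0)
    (hvsa : ∀ j j' : V, G.v (Sum.inr (Sum.inr j)) (some (Sum.inr (Sum.inr j'))) =
      if j = j' then (k : ℝ) + 3 else 0)
    (xhat : (↥E ⊕ V ⊕ V) → Option (↥E ⊕ V ⊕ V) → ℝ)
    (hxe : ∀ (e : ↥E) m, xhat (Sum.inl e) m = if m = some (Sum.inl e) then 1 else 0)
    (hxj : ∀ (j : V) m, xhat (Sum.inr (Sum.inl j)) m =
      if m = some (Sum.inr (Sum.inl j)) then 1 else 0)
    (hxs : ∀ (j : V) m, xhat (Sum.inr (Sum.inr j)) m =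
      if m = some (Sum.inr (Sum.inr j)) then 1 / ((k : ℝ) + 2) else 0) :
    (∀ p : Option (↥E ⊕ V ⊕ V) → ℝ, G.IsPrice p → G.Consistent xhat p →
      ((sInf {c : ℕ | ∃ C : Finset V, (∀ S ∈ E, ∃ j ∈ C, j ∈ S) ∧ C.card = c} : ℕ) : ℝ) ≤
        ∑ m, G.subsidy xhat p m) ∧
    IsLeast {r : ℝ | ∃ p : Option (↥E ⊕ V ⊕ V) → ℝ,
        G.IsPrice p ∧ G.Consistent xhat p ∧ r = ∑ m, G.subsidy xhat p m}
      ((sInf {c : ℕ | ∃ C : Finset V, (∀ S ∈ E, ∃ j ∈ C, j ∈ S) ∧ C.card = c} : ℕ) : ℝ) := by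
  have hG : IsNodeCoverGame k E G := ⟨hab, hμe, hμj, hμs, hcost, hve, hven, hvea, hvje, hvjn,
    hvja, hvse, hvsn, hvsa⟩
  have hx : ∀ i m, xhat i m = if m = some i then G.μ i else 0 := by
    rintro (e | j | j) m
    · rw [hxe, hμe]
    · rw [hxj, hμj]
    · rw [hxs, hμs]
  have hlower : ∀ p : Option (↥E ⊕ V ⊕ V) → ℝ, G.IsPrice p → G.Consistent xhat p →
      ((sInf {c : ℕ | ∃ C : Finset V, (∀ S ∈ E, ∃ j ∈ C, j ∈ S) ∧ C.card = c} : ℕ) : ℝ) ≤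
        ∑ m, G.subsidy xhat p m := by
    intro p hp hcons
    obtain ⟨C, hC, hcard⟩ := hG.exists_cover_le_sum_subsidy hk hE hx hp hcons
    exact le_trans (Nat.cast_le.2 (Nat.sInf_le ⟨C, hC, rfl⟩)) hcard
  refine ⟨hlower, ?_, ?_⟩
  · obtain ⟨C, hC, hcard⟩ : sInf {c : ℕ | ∃ C : Finset V, (∀ S ∈ E, ∃ j ∈ C, j ∈ S) ∧
        C.card = c} ∈ {c : ℕ | ∃ C : Finset V, (∀ S ∈ E, ∃ j ∈ C, j ∈ S) ∧ C.card = c} := by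
      refine Nat.sInf_mem ⟨_, Finset.univ, fun S hS => ?_, rfl⟩
      obtain ⟨j, hj⟩ := Finset.card_pos.1 (by rw [hE S hS]; lia : 0 < S.card)
      exact ⟨j, Finset.mem_univ j, hj⟩
    obtain ⟨p, hp, hcons, hle⟩ := hG.exists_price_sum_subsidy_le hk hE hx C hC
    exact ⟨p, hp, hcons, le_antisymm (hlower p hp hcons) (hcard ▸ hle)⟩
  · rintro r ⟨p, hp, hcons, rfl⟩
    exact hlower p hp hcons
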